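/- arXiv:2205.12122 — 6 statements merged into one kernel-verified Lean document; each statement's English description precedes it below -/
import Mathlib

section
/- If G is an n-extendable graph, then G is (n+1)-connected, i.e., G has more than n+1 vertices and the deletion of any set of at most n vertices from G leaves a connected graph. -/
/-- A graph `G` on a finite vertex type is `n`-extendable if it is connected, has at
least `2n+2` vertices, has a matching with `n` edges, and every matching with `n`
edges is contained in a perfect matching of `G`. -/
def SimpleGraph.IsNExtendable {V : Type*} [Fintype V] (G : SimpleGraph V) (n : ℕ) : Prop :=
  G.Connected ∧ 2 * n + 2 ≤ Fintype.card V ∧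
    (∃ M : G.Subgraph, M.IsMatching ∧ M.edgeSet.ncard = n) ∧
    ∀ M : G.Subgraph, M.IsMatching → M.edgeSet.ncard = n →
      ∃ M' : G.Subgraph, M'.IsPerfectMatching ∧ M ≤ M'

namespace NExt

variable {V : Type*} [Fintype V] [DecidableEq V]

/-- An involution moving vertices only along edges, i.e. a matching. -/
def Mat (G : SimpleGraph V) (f : V → V) : Prop :=
  (∀ v, f (f v) = v) ∧ ∀ v, f v ≠ v → G.Adj v (f v)

/-- Covered vertices. -/
def sup (f : V → V) : Finset V := Finset.univ.filter (fun v => f v ≠ v)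

/-- Every matching with `m` edges extends to a perfect one. -/
def Ext (G : SimpleGraph V) (m : ℕ) : Prop :=
  ∀ f, Mat G f → (sup f).card = 2 * m →
    ∃ g, Mat G g ∧ (∀ v, g v ≠ v) ∧ ∀ v, f v ≠ v → g v = f v

theorem ofSub {G : SimpleGraph V} {M : G.Subgraph} (hM : M.IsPerfectMatching) :
    ∃ g, Mat G g ∧ (∀ v, g v ≠ v) ∧ ∀ a b, M.Adj a b → g a = b := by
  rw [SimpleGraph.Subgraph.isPerfectMatching_iff] at hM
  choose g hg hu using hM
  refine ⟨g, ⟨fun v => (hu (g v) v (hg v).symm).symm, fun v _ => (hg v).adj_sub⟩,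
    fun v => (hg v).adj_sub.ne', fun a b h => (hu a b h).symm⟩

theorem ext_of {G : SimpleGraph V} {n : ℕ} (h : G.IsNExtendable n) : Ext G n := by
  classical
  intro f hf hc
  let M : G.Subgraph :=
    { verts := {v | f v ≠ v}
      Adj := fun a b => f a = b ∧ a ≠ b
      adj_sub := by
        rintro a b ⟨rfl, h⟩
        exact hf.2 _ h.symm
      edge_vert := by
        rintro a b ⟨rfl, h⟩
        exact h.symm
      symm := ⟨by
        rintro a b ⟨rfl, h⟩
        exact ⟨hf.1 a, h.symm⟩⟩ }
  have hM : M.IsMatching := by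
    intro v hv
    refine ⟨f v, ⟨rfl, Ne.symm hv⟩, ?_⟩
    rintro y ⟨h, _⟩
    exact h.symm
  have hcard : M.edgeSet.ncard = n := by
    rw [← SimpleGraph.Subgraph.edgeSet_spanningCoe]
    have h1 := M.spanningCoe.sum_degrees_eq_twice_card_edges
    have h2 : ∀ v, M.spanningCoe.degree v = if f v ≠ v then 1 else 0 := by
      intro v
      have : M.spanningCoe.neighborFinset v = if f v ≠ v then {f v} else ∅ := by
        ext w
        simp only [SimpleGraph.mem_neighborFinset, SimpleGraph.Subgraph.spanningCoe_adj, M]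
        split_ifs with hh
        · simp only [Finset.mem_singleton]
          grind
        · simp only [Finset.notMem_empty]
          grind
      rw [← SimpleGraph.card_neighborFinset_eq_degree, this]
      split_ifs <;> simp
    simp_rw [h2] at h1
    rw [← Finset.card_filter] at h1
    have h3 : (sup f).card = 2 * M.spanningCoe.edgeFinset.card := h1
    rw [← SimpleGraph.coe_edgeFinset, Set.ncard_coe_finset]
    omega
  obtain ⟨M', hM', hle⟩ := h.2.2.2 M hM hcard
  obtain ⟨g, hg, hg1, hg2⟩ := ofSub hM'
  exact ⟨g, hg, hg1, fun v hv => hg2 _ _ (hle.2 ⟨rfl, Ne.symm hv⟩)⟩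

theorem exists_pm {G : SimpleGraph V} {n : ℕ} (h : G.IsNExtendable n) :
    ∃ p, Mat G p ∧ ∀ v, p v ≠ v := by
  obtain ⟨M, hM, hc⟩ := h.2.2.1
  obtain ⟨M', hM', hle⟩ := h.2.2.2 M hM hc
  obtain ⟨g, hg, hg1, hg2⟩ := ofSub hM'
  exact ⟨g, hg, hg1⟩

theorem down {G : SimpleGraph V} {m : ℕ} (h : Ext G (m + 1)) (hV : 2 * m + 4 ≤ Fintype.card V)
    (p : V → V) (hp : Mat G p) (hp1 : ∀ v, p v ≠ v) : Ext G m := by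
  suffices H : ∀ k, ∀ f, Mat G f → (sup f).card = 2 * m →
      (Finset.univ.filter (fun v => f v ≠ v ∧ f v ≠ p v)).card = k →
      ∃ g, Mat G g ∧ (∀ v, g v ≠ v) ∧ ∀ v, f v ≠ v → g v = f v from
    fun f hf hc => H _ f hf hc rfl
  intro k
  induction k using Nat.strong_induction_on with
  | _ k ih =>
  intro f hf hc hk
  by_cases hab : ∃ a b, G.Adj a b ∧ f a = a ∧ f b = b
  · obtain ⟨a, b, hab, ha, hb⟩ := hab
    have hne := hab.ne
    let f' : V → V := fun v => if v = a then b else if v = b then a else f v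
    have hf1 := hf.1
    have hf2 := hf.2
    have hf' : Mat G f' := by
      constructor
      · intro v
        simp only [f']
        grind
      · intro v
        simp only [f']
        have := hab.symm
        grind
    have hs : sup f' = insert a (insert b (sup f)) := by
      ext v
      simp only [sup, f', Finset.mem_filter, Finset.mem_univ, true_and, Finset.mem_insert]
      grind
    have hs2 : (sup f').card = 2 * (m + 1) := by
      rw [hs, Finset.card_insert_of_notMem, Finset.card_insert_of_notMem, hc]
      · ring
      · simp [sup, hb]
      · simp [sup, ha, hne]
    obtain ⟨g, hg, hg1, hg2⟩ := h f' hf' hs2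
    refine ⟨g, hg, hg1, fun v hv => ?_⟩
    have := hg2 v
    simp only [f'] at this
    grind
  · push Not at hab
    have hfix : 4 ≤ (Finset.univ.filter (fun v => f v = v)).card := by
      have := Finset.card_filter_add_card_filter_not (s := (Finset.univ : Finset V))
        (fun v => f v = v)
      have h2 : (sup f).card = (Finset.univ.filter (fun v => ¬ f v = v)).card := rfl
      rw [Finset.card_univ] at this
      omega
    obtain ⟨u, hu⟩ : (Finset.univ.filter (fun v => f v = v)).Nonempty := by
      rw [← Finset.card_pos]; omega
    obtain ⟨x, hx, y, hy, hxy⟩ := Finset.one_lt_card.1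
      (show 1 < ((Finset.univ.filter (fun v => f v = v)).erase u).card by
        rw [Finset.card_erase_of_mem hu]; omega)
    simp only [Finset.mem_erase, Finset.mem_filter, Finset.mem_univ, true_and] at hx hy hu
    have hf1 := hf.1
    have hf2 := hf.2
    have hpu := hp.2 u (hp1 u)
    have hpp := hp.1 u
    have hpu1 := hp1 u
    have hfu : f (p u) ≠ p u := hab _ _ hpu hu
    obtain ⟨u', hu'⟩ : ∃ u', p u = u' := ⟨_, rfl⟩
    rw [hu'] at hpu hpp hpu1 hfu
    obtain ⟨w, hw⟩ : ∃ w, f u' = w := ⟨_, rfl⟩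
    rw [hw] at hfu
    have hfw : f w = u' := by rw [← hw, hf1]
    let f' : V → V := fun v => if v = u then u' else if v = u' then u else if v = w then w else f v
    have huw : u ≠ w := by rintro rfl; grind
    have hf' : Mat G f' := by
      constructor
      · intro v
        simp only [f']
        grind
      · intro v
        simp only [f']
        have := hpu.symm
        grind
    have hs : sup f' = insert u ((sup f).erase w) := by
      ext v
      simp only [sup, f', Finset.mem_filter, Finset.mem_univ, true_and, Finset.mem_insert,
        Finset.mem_erase]
      grind
    have hs2 : (sup f').card = 2 * m := by
      have hwm : w ∈ sup f := by simp [sup, hfw, hfu.symm]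
      rw [hs, Finset.card_insert_of_notMem (by simp [sup, hu]), Finset.card_erase_add_one hwm, hc]
    have hlt : (Finset.univ.filter (fun v => f' v ≠ v ∧ f' v ≠ p v)).card < k := by
      rw [← hk]
      apply Finset.card_lt_card
      rw [Finset.ssubset_iff_of_subset]
      · refine ⟨u', ?_, ?_⟩
        · simp only [Finset.mem_filter, Finset.mem_univ, true_and]
          grind
        · simp only [Finset.mem_filter, Finset.mem_univ, true_and, f']
          grind
      · intro v
        simp only [Finset.mem_filter, Finset.mem_univ, true_and, f']
        grind
    obtain ⟨g, hg, hg1, hg2⟩ := ih _ hlt f' hf' hs2 rfl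
    exfalso
    have key : ∀ x, f x = x → x ≠ u → g x = w := by
      intro x hx hxu
      have a1 := hab _ _ (hg.2 x (hg1 x)) hx
      have a2 := hg2 (g x)
      have a3 := hg.1 x
      have a4 := hf1 (g x)
      simp only [f'] at a2
      have a5 := hg.1 u
      have a6 := hg2 u
      simp only [f'] at a6
      grind
    have k1 := key x hx.2 hx.1
    have k2 := key y hy.2 hy.1
    have := hg.1 x
    have := hg.1 y
    grind

theorem ext_le {G : SimpleGraph V} {n : ℕ} (h : Ext G n) (hV : 2 * n + 2 ≤ Fintype.card V)
    (p : V → V) (hp : Mat G p) (hp1 : ∀ v, p v ≠ v) (k : ℕ) (hk : k ≤ n) : Ext G k := by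
  induction n with
  | zero => obtain rfl : k = 0 := by omega
            exact h
  | succ n ih =>
    rcases Nat.lt_or_ge n k with h1 | h1
    · obtain rfl : k = n + 1 := by omega
      exact h
    · exact ih (down h (by omega) p hp hp1) (by omega) h1

/-- `A` and `B` are nonempty and separated. -/
def Sep (G : SimpleGraph V) (A B : Finset V) : Prop :=
  A.Nonempty ∧ B.Nonempty ∧ Disjoint A B ∧ ∀ a ∈ A, ∀ b ∈ B, ¬ G.Adj a b

theorem Sep.symm {G : SimpleGraph V} {A B : Finset V} (h : Sep G A B) : Sep G B A :=
  ⟨h.2.1, h.1, h.2.2.1.symm, fun a ha b hb hab => h.2.2.2 b hb a ha hab.symm⟩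

theorem hall {G : SimpleGraph V} {A B : Finset V} (h : Sep G A B)
    (hmax : ∀ A' B', Sep G A' B' → A'.card + B'.card ≤ A.card + B.card)
    (T : Finset V) (hTA : Disjoint T A) (hTB : Disjoint T B) (hT : T.card ≤ A.card) :
    ∃ φ : T → V, Function.Injective φ ∧ ∀ t : T, φ t ∈ A ∧ G.Adj t (φ t) := by
  classical
  obtain ⟨φ, h1, h2⟩ := (Finset.all_card_le_biUnion_card_iff_exists_injective
    (fun t : T => A.filter (fun a => G.Adj t a))).1 (by
      intro X
      by_contra hlt
      push Not at hlt
      set Y := X.biUnion (fun t : T => A.filter (fun a => G.Adj t a)) with hY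
      have hYA : Y ⊆ A := by
        intro y
        simp only [hY, Finset.mem_biUnion, Finset.mem_filter]
        rintro ⟨_, _, h, _⟩
        exact h
      have hXT : X.card ≤ T.card := by
        simpa using Finset.card_le_univ X
      have hX : (X.map (Function.Embedding.subtype _)).card = X.card := Finset.card_map _
      set X' := X.map (Function.Embedding.subtype _) with hX'
      have hXT' : X' ⊆ T := by
        intro x
        simp only [hX', Finset.mem_map]
        rintro ⟨y, _, rfl⟩
        exact y.2
      have hc1 := Finset.card_sdiff_add_card_eq_card hYA
      have hBX : Disjoint B X' := (hTB.mono_left hXT').symm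
      have := hmax (A \ Y) (B ∪ X') ⟨?_, ?_, ?_, ?_⟩
      · rw [Finset.card_union_of_disjoint hBX] at this
        omega
      · rw [← Finset.card_pos]; omega
      · exact h.2.1.mono Finset.subset_union_left
      · rw [Finset.disjoint_union_right]
        exact ⟨h.2.2.1.mono_left Finset.sdiff_subset,
          (hTA.mono_left hXT').symm.mono_left Finset.sdiff_subset⟩
      · intro a ha b hb hab
        rw [Finset.mem_sdiff] at ha
        rcases Finset.mem_union.1 hb with hb | hb
        · exact h.2.2.2 a ha.1 b hb hab
        · simp only [hX', Finset.mem_map] at hb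
          obtain ⟨y, hy, rfl⟩ := hb
          apply ha.2
          simp only [hY, Finset.mem_biUnion, Finset.mem_filter]
          exact ⟨y, hy, ha.1, hab.symm⟩)
  exact ⟨φ, h1, fun t => by simpa using h2 t⟩

theorem even_of_invol (A : Finset V) (g : V → V) (h1 : ∀ a ∈ A, g a ∈ A) (h2 : ∀ a, g (g a) = a)
    (h3 : ∀ a, g a ≠ a) : Even A.card := by
  have : ∑ a ∈ A, (1 : ZMod 2) = 0 :=
    Finset.sum_involution (fun a _ => g a) (fun _ _ => by decide) (fun a _ _ => h3 a)
      (fun a ha => h1 a ha) (fun a _ => h2 a)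
  simp only [Finset.sum_const, nsmul_eq_mul, mul_one] at this
  rwa [ZMod.natCast_eq_zero_iff_even] at this

theorem parity {G : SimpleGraph V} {A B : Finset V} (h : Sep G A B)
    (hmax : ∀ A' B', Sep G A' B' → A'.card + B'.card ≤ A.card + B.card)
    (S : Finset V) (hS : S = (A ∪ B)ᶜ) (hext : Ext G S.card) (j : ℕ) (hj : j ≤ S.card)
    (hjA : j ≤ A.card) (hjB : S.card - j ≤ B.card) : Even (A.card - j) := by
  classical
  have hSm : ∀ v, v ∈ S ↔ v ∉ A ∧ v ∉ B := by
    intro v; simp [hS]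
  obtain ⟨T, hTS, hTc⟩ := Finset.exists_subset_card_eq hj
  have hAB : ∀ v ∈ A, v ∉ B := fun v h1 h2 => Finset.disjoint_left.1 h.2.2.1 h1 h2
  obtain ⟨φ, hφ, hφ2⟩ := hall h hmax T
    (Finset.disjoint_left.2 fun v hv => ((hSm v).1 (hTS hv)).1)
    (Finset.disjoint_left.2 fun v hv => ((hSm v).1 (hTS hv)).2) (by omega)
  obtain ⟨ψ, hψ, hψ2⟩ := hall h.symm (fun A' B' h' => by have := hmax _ _ h'; omega) (S \ T)
    (Finset.disjoint_left.2 fun v hv => ((hSm v).1 (Finset.sdiff_subset hv)).2)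
    (Finset.disjoint_left.2 fun v hv => ((hSm v).1 (Finset.sdiff_subset hv)).1)
    (by rw [Finset.card_sdiff_of_subset hTS]; omega)
  obtain ⟨θ, hθT, hθS, hinj⟩ : ∃ θ : V → V, (∀ t ∈ T, θ t ∈ A ∧ G.Adj t (θ t)) ∧
      (∀ t ∈ S, t ∉ T → θ t ∈ B ∧ G.Adj t (θ t)) ∧ ∀ s ∈ S, ∀ t ∈ S, θ s = θ t → s = t := by
    refine ⟨fun v => if hv : v ∈ T then φ ⟨v, hv⟩ else if hv : v ∈ S \ T then ψ ⟨v, hv⟩ else v,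
      ?_, ?_, ?_⟩
    · intro t ht
      simp only [ht, dite_true]
      exact hφ2 ⟨t, ht⟩
    · intro t ht ht'
      have ht2 : t ∈ S \ T := Finset.mem_sdiff.2 ⟨ht, ht'⟩
      simp only [ht', ht2, dite_true, dite_false]
      exact hψ2 ⟨t, ht2⟩
    · intro s hs t ht hst
      by_cases hs' : s ∈ T <;> by_cases ht' : t ∈ T
      · simp only [hs', ht', dite_true] at hst
        simpa using hφ hst
      · have ht2 : t ∈ S \ T := Finset.mem_sdiff.2 ⟨ht, ht'⟩
        simp only [hs', ht', ht2, dite_true, dite_false] at hst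
        have a1 := (hφ2 ⟨s, hs'⟩).1
        have a2 := (hψ2 ⟨t, ht2⟩).1
        rw [hst] at a1
        exact (hAB _ a1 a2).elim
      · have hs2 : s ∈ S \ T := Finset.mem_sdiff.2 ⟨hs, hs'⟩
        simp only [hs', ht', hs2, dite_true, dite_false] at hst
        have a1 := (hφ2 ⟨t, ht'⟩).1
        have a2 := (hψ2 ⟨s, hs2⟩).1
        rw [hst] at a2
        exact (hAB _ a1 a2).elim
      · have ht2 : t ∈ S \ T := Finset.mem_sdiff.2 ⟨ht, ht'⟩
        have hs2 : s ∈ S \ T := Finset.mem_sdiff.2 ⟨hs, hs'⟩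
        simp only [hs', ht', ht2, hs2, dite_true, dite_false] at hst
        simpa using hψ hst
  have hθadj : ∀ s ∈ S, G.Adj s (θ s) := fun s hs => by
    by_cases hs' : s ∈ T
    · exact (hθT s hs').2
    · exact (hθS s hs hs').2
  have hθn : ∀ s ∈ S, θ s ∉ S := fun s hs => by
    rw [hSm]
    by_cases hs' : s ∈ T
    · have := (hθT s hs').1; tauto
    · have := (hθS s hs hs').1; tauto
  obtain ⟨f, hfS, hfθ, hfo⟩ : ∃ f : V → V, (∀ s ∈ S, f s = θ s) ∧ (∀ s ∈ S, f (θ s) = s) ∧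
      ∀ v, v ∉ S → (∀ s ∈ S, θ s ≠ v) → f v = v := by
    refine ⟨fun v => if v ∈ S then θ v else if hv : ∃ s, s ∈ S ∧ θ s = v then hv.choose else v,
      ?_, ?_, ?_⟩
    · intro s hs; simp [hs]
    · intro s hs
      have hv : ∃ t, t ∈ S ∧ θ t = θ s := ⟨s, hs, rfl⟩
      simp only [hθn s hs, if_false, dif_pos hv]
      exact hinj _ hv.choose_spec.1 _ hs hv.choose_spec.2
    · intro v hv hv2
      have : ¬ ∃ s, s ∈ S ∧ θ s = v := by rintro ⟨s, hs, h⟩; exact hv2 s hs h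
      simp [hv, this]
  have htri : ∀ v, v ∈ S ∨ (∃ s ∈ S, θ s = v) ∨ (v ∉ S ∧ ∀ s ∈ S, θ s ≠ v) := by
    intro v; by_cases h1 : v ∈ S
    · exact Or.inl h1
    · by_cases h2 : ∃ s ∈ S, θ s = v
      · exact Or.inr (Or.inl h2)
      · push Not at h2
        exact Or.inr (Or.inr ⟨h1, h2⟩)
  have hf : Mat G f := by
    constructor
    · intro v
      rcases htri v with h1 | ⟨s, hs, rfl⟩ | ⟨h1, h2⟩
      · rw [hfS v h1, hfθ v h1]
      · rw [hfθ s hs, hfS s hs]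
      · rw [hfo v h1 h2, hfo v h1 h2]
    · intro v hv
      rcases htri v with h1 | ⟨s, hs, rfl⟩ | ⟨h1, h2⟩
      · rw [hfS v h1]; exact hθadj v h1
      · rw [hfθ s hs]; exact (hθadj s hs).symm
      · exact absurd (hfo v h1 h2) hv
  have hsup : sup f = S ∪ S.image θ := by
    ext v
    simp only [sup, Finset.mem_filter, Finset.mem_univ, true_and, Finset.mem_union,
      Finset.mem_image]
    rcases htri v with h1 | ⟨s, hs, rfl⟩ | ⟨h1, h2⟩
    · simp only [h1, true_or, iff_true, hfS v h1]
      exact (hθadj v h1).ne'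
    · rw [hfθ s hs]
      have := (hθadj s hs).ne
      exact ⟨fun _ => Or.inr ⟨s, hs, rfl⟩, fun _ => this⟩
    · have := hfo v h1 h2
      grind
  have hsc : (sup f).card = 2 * S.card := by
    rw [hsup, Finset.card_union_of_disjoint, Finset.card_image_of_injOn]
    · ring
    · intro s hs t ht; exact hinj s hs t ht
    · rw [Finset.disjoint_left]
      intro v hv hv'
      obtain ⟨s, hs, rfl⟩ := Finset.mem_image.1 hv'
      exact hθn s hs hv
  obtain ⟨g, hg, hg1, hg2⟩ := hext f hf hsc
  have hgS : ∀ s ∈ S, g s = θ s := fun s hs => by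
    rw [hg2 s, hfS s hs]
    rw [hfS s hs]; exact (hθadj s hs).ne'
  have hgθ : ∀ s ∈ S, g (θ s) = s := fun s hs => by
    rw [← hgS s hs, hg.1]
  have hsub : T.image θ ⊆ A := by
    intro v hv
    obtain ⟨s, hs, rfl⟩ := Finset.mem_image.1 hv
    exact (hθT s hs).1
  have hev := even_of_invol (A \ T.image θ) g (by
    intro a ha
    rw [Finset.mem_sdiff] at ha
    have hadj := hg.2 a (hg1 a)
    have hnS : g a ∉ S := by
      intro hs
      have e1 := hgS _ hs
      rw [hg.1] at e1
      by_cases hT : g a ∈ T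
      · exact ha.2 (Finset.mem_image.2 ⟨_, hT, e1.symm⟩)
      · have := (hθS _ hs hT).1
        rw [← e1] at this
        exact hAB _ ha.1 this
    have hnB : g a ∉ B := fun hb => h.2.2.2 a ha.1 _ hb hadj
    have hA : g a ∈ A := by
      by_contra hA
      exact hnS ((hSm _).2 ⟨hA, hnB⟩)
    refine Finset.mem_sdiff.2 ⟨hA, fun him => ?_⟩
    obtain ⟨s, hs, e⟩ := Finset.mem_image.1 him
    have e2 := hgθ s (hTS hs)
    rw [e, hg.1] at e2
    rw [e2] at ha
    exact ((hSm s).1 (hTS hs)).1 ha.1) hg.1 hg1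
  rw [Finset.card_sdiff_of_subset hsub, Finset.card_image_of_injOn, hTc] at hev
  · exact hev
  · intro s hs t ht; exact hinj s (hTS hs) t (hTS ht)

theorem exists_sep {G : SimpleGraph V} {S : Finset V} (hS : S.card < Fintype.card V)
    (h : ¬ (G.induce ((↑S : Set V)ᶜ)).Connected) :
    ∃ A B, Sep G A B ∧ A.card + B.card + S.card = Fintype.card V := by
  classical
  have hne : Nonempty ((↑S : Set V)ᶜ : Set V) := by
    obtain ⟨x, hx⟩ : ∃ x, x ∉ S := by
      by_contra hh
      push Not at hh
      rw [Finset.eq_univ_iff_forall.2 hh, Finset.card_univ] at hS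
      omega
    exact ⟨⟨x, by simpa using hx⟩⟩
  rw [SimpleGraph.connected_iff] at h
  have h' : ¬ (G.induce ((↑S : Set V)ᶜ)).Preconnected := fun hp => h ⟨hp, hne⟩
  unfold SimpleGraph.Preconnected at h'
  push Not at h'
  obtain ⟨x, y, hxy⟩ := h'
  let P : V → Prop := fun v => ∃ hv : v ∈ ((↑S : Set V)ᶜ), (G.induce ((↑S : Set V)ᶜ)).Reachable x ⟨v, hv⟩
  have hxS : (x : V) ∉ S := fun hh => x.2 (Finset.mem_coe.2 hh)
  have hyS : (y : V) ∉ S := fun hh => y.2 (Finset.mem_coe.2 hh)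
  have hd : Disjoint ((Sᶜ).filter P) ((Sᶜ).filter (fun v => ¬ P v)) :=
    Finset.disjoint_filter_filter_not _ _ _
  refine ⟨(Sᶜ).filter P, (Sᶜ).filter (fun v => ¬ P v), ⟨⟨x, ?_⟩, ⟨y, ?_⟩, hd, ?_⟩, ?_⟩
  · simp only [Finset.mem_filter, Finset.mem_compl]
    exact ⟨hxS, x.2, SimpleGraph.Reachable.refl _⟩
  · simp only [Finset.mem_filter, Finset.mem_compl]
    exact ⟨hyS, fun ⟨_, hh⟩ => hxy hh⟩
  · intro a ha b hb hab
    simp only [Finset.mem_filter, Finset.mem_compl] at ha hb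
    obtain ⟨ha1, ha2, ha3⟩ := ha
    have hb1 : b ∈ ((↑S : Set V)ᶜ) := by simpa using hb.1
    refine hb.2 ⟨hb1, ha3.trans (SimpleGraph.Adj.reachable ?_)⟩
    simpa using hab
  · rw [Finset.card_filter_add_card_filter_not, Finset.card_compl]
    omega

theorem sep_compl_nonempty {G : SimpleGraph V} (hG : G.Connected) {A B : Finset V}
    (h : Sep G A B) : A.card + B.card < Fintype.card V := by
  by_contra hh
  obtain ⟨⟨a, ha⟩, ⟨b, hb⟩, hd, hn⟩ := h
  have hu : A ∪ B = Finset.univ := by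
    apply Finset.eq_univ_of_card
    have := Finset.card_le_univ (A ∪ B)
    rw [Finset.card_union_of_disjoint hd] at this ⊢
    omega
  have hclosed : ∀ v, G.Reachable a v → v ∈ A := by
    intro v hv
    obtain ⟨w⟩ := hv
    clear hb
    induction w with
    | nil => exact ha
    | @cons u v' w' hadj _ ih =>
      apply ih
      have : v' ∈ A ∪ B := by rw [hu]; exact Finset.mem_univ _
      rcases Finset.mem_union.1 this with h1 | h1
      · exact h1
      · exact (hn _ ha _ h1 hadj).elim
  exact Finset.disjoint_left.1 hd (hclosed b (hG.preconnected a b)) hb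

theorem no_sep {G : SimpleGraph V} {n : ℕ} (h : G.IsNExtendable n) {A B : Finset V}
    (hs : Sep G A B) : A.card + B.card + n < Fintype.card V := by
  classical
  by_contra hcon
  obtain ⟨⟨A', B'⟩, hm, hmax⟩ := Finset.exists_max_image
    (Finset.univ.filter (fun q : Finset V × Finset V => Sep G q.1 q.2))
    (fun q => q.1.card + q.2.card) ⟨(A, B), by simpa using hs⟩
  simp only [Finset.mem_filter, Finset.mem_univ, true_and, Prod.forall] at hm hmax
  have hle := hmax A B hs
  have hlt := sep_compl_nonempty h.1 hm
  have hV := h.2.1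
  obtain ⟨p, hp, hp1⟩ := exists_pm h
  have hc : ((A' ∪ B')ᶜ).card = Fintype.card V - (A'.card + B'.card) := by
    rw [Finset.card_compl, Finset.card_union_of_disjoint hm.2.2.1]
  have hA := Finset.card_pos.2 hm.1
  have hB := Finset.card_pos.2 hm.2.1
  have hext := ext_le (ext_of h) hV p hp hp1 ((A' ∪ B')ᶜ).card (by omega)
  have e1 := parity hm hmax _ rfl hext (((A' ∪ B')ᶜ).card - B'.card) (by omega) (by omega)
    (by omega)
  have e2 := parity hm hmax _ rfl hext (((A' ∪ B')ᶜ).card - B'.card + 1) (by omega) (by omega)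
    (by omega)
  rw [Nat.even_iff] at e1 e2
  omega

end NExt

theorem nExtendable_connectivity {V : Type*} [Fintype V] (G : SimpleGraph V) (n : ℕ)
    (h : G.IsNExtendable n) :
    n + 1 < Fintype.card V ∧
      ∀ S : Finset V, S.card ≤ n → (G.induce ((↑S : Set V)ᶜ)).Connected := by
  classical
  have hV := h.2.1
  refine ⟨by omega, fun S hS => ?_⟩
  by_contra hc
  obtain ⟨A, B, hs, hcard⟩ := NExt.exists_sep (by omega) hc
  have := NExt.no_sep h hs
  omega
end

section
/- For every integer n ≥ 1, every n-extendable graph is (n−1)-extendable. -/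
/-- A matching encoded as an involution. -/
def MInv {V : Type*} (G : SimpleGraph V) (f : V → V) : Prop :=
  (∀ x, f (f x) = x) ∧ ∀ x, f x ≠ x → G.Adj x (f x)

def MInv.sub {V : Type*} {G : SimpleGraph V} {f : V → V} (hf : MInv G f) : G.Subgraph where
  verts := {x | f x ≠ x}
  Adj x y := x ≠ y ∧ f x = y
  adj_sub := by
    rintro x y ⟨h1, rfl⟩
    exact hf.2 x h1.symm
  edge_vert := by
    rintro x y ⟨h1, rfl⟩
    exact h1.symm
  symm := by
    constructor
    rintro x y ⟨h1, rfl⟩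
    exact ⟨h1.symm, hf.1 x⟩

theorem MInv.sub_isMatching {V : Type*} {G : SimpleGraph V} {f : V → V} (hf : MInv G f) :
    hf.sub.IsMatching := by
  intro x hx
  exact ⟨f x, ⟨fun h => hx h.symm, rfl⟩, fun y hy => hy.2.symm⟩

theorem exists_minv {V : Type*} {G : SimpleGraph V} (M : G.Subgraph) (hM : M.IsMatching) :
    ∃ f : V → V, MInv G f ∧ (∀ x y, M.Adj x y ↔ x ≠ y ∧ f x = y) ∧
      ∀ x, x ∈ M.verts ↔ f x ≠ x := by
  classical
  have h1 : ∀ x, ∃ y, (x ∈ M.verts → M.Adj x y) ∧ (x ∉ M.verts → y = x) := by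
    intro x
    by_cases hx : x ∈ M.verts
    · obtain ⟨y, hy, -⟩ := hM hx
      exact ⟨y, fun _ => hy, fun h => absurd hx h⟩
    · exact ⟨x, fun h => absurd h hx, fun _ => rfl⟩
  choose f hf1 hf2 using h1
  have hadj : ∀ x y, M.Adj x y ↔ x ≠ y ∧ f x = y := by
    intro x y
    constructor
    · intro h
      have hx := M.edge_vert h
      exact ⟨h.ne, (hM hx).unique (hf1 x hx) h⟩
    · rintro ⟨h, rfl⟩
      by_cases hx : x ∈ M.verts
      · exact hf1 x hx
      · exact absurd (hf2 x hx).symm h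
  have hv : ∀ x, x ∈ M.verts ↔ f x ≠ x := by
    intro x
    constructor
    · intro hx
      exact (hf1 x hx).ne.symm
    · intro h
      by_contra hx
      exact h (hf2 x hx)
  refine ⟨f, ⟨?_, ?_⟩, hadj, hv⟩
  · intro x
    by_cases hx : x ∈ M.verts
    · exact ((hadj _ _).1 (hf1 x hx).symm).2
    · rw [hf2 x hx, hf2 x hx]
  · intro x hx
    exact (hf1 x ((hv x).2 hx)).adj_sub

theorem matching_card {V : Type*} [Fintype V] {G : SimpleGraph V} (M : G.Subgraph)
    (hM : M.IsMatching) : 2 * M.edgeSet.ncard = M.verts.ncard := by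
  classical
  have h := M.spanningCoe.sum_degrees_eq_twice_card_edges
  have h2 : M.edgeSet.ncard = M.spanningCoe.edgeFinset.card := by
    rw [← Set.ncard_coe_finset, SimpleGraph.coe_edgeFinset, SimpleGraph.Subgraph.edgeSet_spanningCoe]
  have h3 : ∀ v, M.spanningCoe.degree v = if v ∈ M.verts then 1 else 0 := by
    intro v
    rw [SimpleGraph.Subgraph.degree_spanningCoe]
    split_ifs with hv
    · exact SimpleGraph.Subgraph.degree_eq_one_iff_existsUnique_adj.2 (hM hv)
    · exact M.degree_of_notMem_verts hv
  rw [h2, ← h, Finset.sum_congr rfl (fun v _ => h3 v), Finset.sum_boole]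
  rw [← Set.ncard_coe_finset]
  simp

theorem minv_core {V : Type*} [Fintype V] [DecidableEq V] (G : SimpleGraph V) (m : ℕ)
    (hc : 2 * m + 4 ≤ Fintype.card V)
    (h : ∀ f, MInv G f → (Finset.univ.filter fun x => f x ≠ x).card = 2 * m + 2 →
      ∃ g, MInv G g ∧ (∀ x, g x ≠ x) ∧ ∀ x, f x ≠ x → g x = f x)
    (P : V → V) (hP : MInv G P) (hP' : ∀ x, P x ≠ x) (k : ℕ) :
    ∀ f, MInv G f → (Finset.univ.filter fun x => f x ≠ x).card = 2 * m →
      (Finset.univ.filter fun x => f x ≠ P x).card ≤ k →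
      ∃ g, MInv G g ∧ (∀ x, g x ≠ x) ∧ ∀ x, f x ≠ x → g x = f x := by
  induction k with
  | zero =>
    intro f hf hfc hk
    refine ⟨P, hP, hP', fun x _ => ?_⟩
    by_contra hne
    have : x ∈ Finset.univ.filter fun x => f x ≠ P x := by simp; exact fun h => hne h.symm
    rw [Finset.card_eq_zero.1 (Nat.le_zero.1 hk)] at this
    simp at this
  | succ k ih =>
    intro f hf hfc hk
    by_cases hU : ∃ u v, f u = u ∧ f v = v ∧ G.Adj u v
    · obtain ⟨u, v, hu, hv, huv⟩ := hU
      have hne := huv.ne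
      have hvu := huv.symm
      have hf1 := hf.1
      have hf2 := hf.2
      obtain ⟨g, hg, hg1, hg2⟩ := h (fun z => if z = u then v else if z = v then u else f z)
        ⟨by intro x; grind, by intro x; grind⟩ (by
          have : (Finset.univ.filter fun x =>
              (if x = u then v else if x = v then u else f x) ≠ x) =
              insert u (insert v (Finset.univ.filter fun x => f x ≠ x)) := by
            ext x; simp; grind
          rw [this, Finset.card_insert_of_notMem (by simp; grind),
            Finset.card_insert_of_notMem (by simp; grind), hfc])
      refine ⟨g, hg, hg1, fun x hx => ?_⟩
      have := hg2 x
      grind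
    · push Not at hU
      have hUc : 4 ≤ (Finset.univ.filter fun x => f x = x).card := by
        have := Finset.card_filter_add_card_filter_not (s := (Finset.univ : Finset V)) (fun x => f x = x)
        simp only [Finset.card_univ] at this
        simp only [ne_eq] at hfc
        omega
      obtain ⟨u, hu⟩ := Finset.card_pos.1 (by omega : 0 < (Finset.univ.filter fun x => f x = x).card)
      simp only [Finset.mem_filter, Finset.mem_univ, true_and] at hu
      obtain ⟨x, hx⟩ : ∃ x, x = P u := ⟨_, rfl⟩
      obtain ⟨y, hy⟩ : ∃ y, y = f x := ⟨_, rfl⟩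
      have hux : G.Adj u x := hx ▸ hP.2 u (hP' u)
      have hxu := hux.symm
      have hne := hux.ne
      have hyx : y ≠ x := fun h => hU u x hu (by rw [← hy, h]) hux
      have hPx : P x = u := by rw [hx, hP.1]
      have hf1 := hf.1
      have hf2 := hf.2
      have hfy : f y = x := by rw [hy, hf1]
      have hyu : y ≠ u := by rintro rfl; exact hne (by rw [← hu, hfy])
      have hPy : P y ≠ x := by
        intro h
        apply hyu
        rw [← hP.1 y, h, hPx]
      obtain ⟨g, hg, hg1, hg2⟩ := ih
        (fun z => if z = x then u else if z = u then x else if z = y then y else f z)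
        ⟨by intro z; grind, by intro z; grind⟩ (by
          have : (Finset.univ.filter fun z =>
              (if z = x then u else if z = u then x else if z = y then y else f z) ≠ z) =
              insert u ((Finset.univ.filter fun x => f x ≠ x).erase y) := by
            ext z; simp; grind
          have hym : y ∈ Finset.univ.filter fun x => f x ≠ x := by simp; grind
          have hpos := Finset.card_pos.2 ⟨y, hym⟩
          rw [this, Finset.card_insert_of_notMem (by simp; grind),
            Finset.card_erase_of_mem hym, hfc]
          omega) (by
          refine Nat.le_of_lt_succ (lt_of_lt_of_le (Finset.card_lt_card ?_) hk)
          rw [Finset.ssubset_iff_of_subset]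
          · exact ⟨x, by simp; grind, by simp; grind⟩
          · intro z; simp; grind)
      exfalso
      have hgg := hg.1
      have hgadj : ∀ z, G.Adj z (g z) := fun z => hg.2 z (hg1 z)
      have hgu : g u = x := by have := hg2 u; grind
      have key : ∀ z, f z = z → z ≠ u → g z = y := by
        intro z hz hzu
        by_contra hzy
        have h1 : f (g z) ≠ g z := fun h => hU z (g z) hz h (hgadj z)
        have h2 := hg2 (g z)
        grind
      have hsub : (Finset.univ.filter fun x => f x = x) ⊆ {u, g y} := by
        intro z hz
        simp at hz ⊢
        by_cases hzu : z = u
        · exact Or.inl hzu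
        · right
          rw [← key z hz hzu, hgg]
      have := (Finset.card_le_card hsub).trans Finset.card_le_two
      omega

/-- For every `n ≥ 1`, every `n`-extendable graph is `(n-1)`-extendable. -/
theorem nExtendable_of_succ {V : Type*} [Fintype V] (G : SimpleGraph V) (n : ℕ)
    (hn : 1 ≤ n) (h : G.IsNExtendable n) : G.IsNExtendable (n - 1) := by
  classical
  obtain ⟨m, rfl⟩ : ∃ m, n = m + 1 := ⟨n - 1, by omega⟩
  obtain ⟨hconn, hcard, ⟨M0, hM0, hM0c⟩, hext⟩ := h
  simp only [Nat.add_sub_cancel]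
  have cnt : ∀ (M : G.Subgraph) (f : V → V), M.IsMatching → (∀ x, x ∈ M.verts ↔ f x ≠ x) →
      2 * M.edgeSet.ncard = (Finset.univ.filter fun x => f x ≠ x).card := by
    intro M f hM hv
    rw [matching_card M hM, ← Set.ncard_coe_finset]
    congr 1
    ext x
    simp [hv]
  have hE : ∀ f, MInv G f → (Finset.univ.filter fun x => f x ≠ x).card = 2 * m + 2 →
      ∃ g, MInv G g ∧ (∀ x, g x ≠ x) ∧ ∀ x, f x ≠ x → g x = f x := by
    intro f hf hfc
    have h1 := cnt hf.sub f hf.sub_isMatching (fun x => Iff.rfl)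
    obtain ⟨M', hM', hle⟩ := hext hf.sub hf.sub_isMatching (by omega)
    obtain ⟨g, hg, hga, hgv⟩ := exists_minv M' hM'.1
    refine ⟨g, hg, fun x => (hgv x).1 (hM'.2 x), fun x hx => ?_⟩
    exact ((hga x (f x)).1 (hle.2 ⟨hx.symm, rfl⟩)).2
  obtain ⟨f0, hf0, -, hv0⟩ := exists_minv M0 hM0
  have hc0 := cnt M0 f0 hM0 hv0
  obtain ⟨P, hP, hP', -⟩ := hE f0 hf0 (by omega)
  refine ⟨hconn, by omega, ?_, ?_⟩
  · obtain ⟨a, ha⟩ := Finset.card_pos.1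
      (by omega : 0 < (Finset.univ.filter fun x => f0 x ≠ x).card)
    have ha' : f0 a ≠ a := by simpa using ha
    obtain ⟨b, hb⟩ : ∃ b, b = f0 a := ⟨_, rfl⟩
    have hf1 := hf0.1
    have hf2 := hf0.2
    have hfb : f0 b = a := by rw [hb, hf1]
    have hf : MInv G (fun z => if z = a then a else if z = b then b else f0 z) :=
      ⟨by intro z; grind, by intro z; grind⟩
    refine ⟨hf.sub, hf.sub_isMatching, ?_⟩
    have h1 := cnt hf.sub _ hf.sub_isMatching (fun x => Iff.rfl)
    have : (Finset.univ.filter fun z => (if z = a then a else if z = b then b else f0 z) ≠ z) =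
        ((Finset.univ.filter fun x => f0 x ≠ x).erase a).erase b := by
      ext z; simp; grind
    rw [this, Finset.card_erase_of_mem (by simp; grind), Finset.card_erase_of_mem ha] at h1
    omega
  · intro M hM hMc
    obtain ⟨f, hf, hfa, hfv⟩ := exists_minv M hM
    have hc := cnt M f hM hfv
    obtain ⟨g, hg, hg1, hg2⟩ := minv_core G m (by omega) hE P hP hP' _ f hf (by omega) le_rfl
    refine ⟨hg.sub, ⟨hg.sub_isMatching, fun x => hg1 x⟩, ⟨fun x _ => hg1 x, ?_⟩⟩
    intro x y hxy
    obtain ⟨h1, rfl⟩ := (hfa x y).1 hxy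
    exact ⟨h1, hg2 x h1.symm⟩
end

section
/- Let G be an n-extendable graph and let v be a vertex of G of degree n + t (for an integer t ≥ 0). Then the subgraph of G induced by the neighborhood N(v) of v does not contain a matching of size t. -/
open Classical in
theorem sum_edges {V : Type*} [Fintype V] {G : SimpleGraph V} (M : G.Subgraph)
    (hM : M.IsMatching) : M.verts.toFinset.card = 2 * M.edgeSet.ncard := by
  have h := M.spanningCoe.sum_degrees_eq_twice_card_edges
  have h1 : M.edgeSet.ncard = M.spanningCoe.edgeFinset.card := by
    rw [← Set.ncard_coe_finset]; simp
  rw [h1, ← h]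
  have : ∀ v, M.spanningCoe.degree v = if v ∈ M.verts then 1 else 0 := by
    intro v
    rw [SimpleGraph.Subgraph.degree_spanningCoe]
    split_ifs with hv
    · exact SimpleGraph.Subgraph.degree_eq_one_iff_existsUnique_adj.mpr (hM hv)
    · exact SimpleGraph.Subgraph.degree_of_notMem_verts hv
  rw [Finset.sum_congr rfl (fun v _ => this v)]
  simp [Set.toFinset_card, Fintype.card_subtype]

/-- matchings as partial involutions -/
def Mat {V : Type*} (G : SimpleGraph V) (S : Finset V) (f : V → V) : Prop :=
  ∀ v ∈ S, f v ∈ S ∧ f (f v) = v ∧ G.Adj v (f v)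

open Classical in
theorem ofSub {V : Type*} [Fintype V] {G : SimpleGraph V} (M : G.Subgraph)
    (hM : M.IsMatching) : ∃ f : V → V, Mat G M.verts.toFinset f ∧ ∀ v ∈ M.verts, M.Adj v (f v) := by
  have h : ∀ v, ∃ w, v ∈ M.verts → M.Adj v w := by
    intro v
    by_cases hv : v ∈ M.verts
    · obtain ⟨w, hw, _⟩ := hM hv
      exact ⟨w, fun _ => hw⟩
    · exact ⟨v, fun h => absurd h hv⟩
  choose f hf using h
  refine ⟨f, ?_, hf⟩
  intro v hv
  have hv : v ∈ M.verts := by simpa using hv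
  have h1 := hf v hv
  have h2 : f v ∈ M.verts := h1.snd_mem
  exact ⟨by simpa using h2, (hM h2).unique (hf _ h2) h1.symm, h1.adj_sub⟩

open Classical in
theorem hypX {V : Type*} [Fintype V] {G : SimpleGraph V} {n : ℕ} (h : G.IsNExtendable n)
    (S : Finset V) (f : V → V) (hS : Mat G S f) (hc : S.card = 2 * n) :
    ∃ g, Mat G Finset.univ g ∧ ∀ v ∈ S, g v = f v := by
  let M : G.Subgraph :=
    { verts := S
      Adj := fun v w => v ∈ S ∧ w = f v
      adj_sub := by rintro v w ⟨h1, rfl⟩; exact (hS v h1).2.2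
      edge_vert := by rintro v w ⟨h1, rfl⟩; exact h1
      symm := ⟨by rintro v w ⟨h1, rfl⟩; exact ⟨(hS v h1).1, (hS v h1).2.1.symm⟩⟩ }
  have hM : M.IsMatching := by
    intro v hv
    exact ⟨f v, ⟨hv, rfl⟩, fun y hy => hy.2⟩
  have hcard := sum_edges M hM
  have hcard : S.card = 2 * M.edgeSet.ncard := by
    rw [← hcard]; congr 1; ext; simp [M]
  obtain ⟨P, ⟨hP, hsp⟩, hle⟩ := h.2.2.2 M hM (by omega)
  obtain ⟨g, hg, hg'⟩ := ofSub P hP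
  refine ⟨g, ?_, ?_⟩
  · intro v _
    have := hg v (by simpa using hsp v)
    exact ⟨Finset.mem_univ _, this.2⟩
  · intro v hv
    exact (hP (hsp v)).unique (hg' v (hsp v)) (hle.2 ⟨hv, rfl⟩)

theorem mat_even {V : Type*} {G : SimpleGraph V} {S : Finset V} {f : V → V}
    (hS : Mat G S f) : Even S.card := by
  have := Finset.sum_involution (s := S) (f := fun _ => (1 : ZMod 2)) (fun a _ => f a)
    (fun a ha => by decide) (fun a ha _ => (hS a ha).2.2.ne')
    (fun a ha => (hS a ha).1) (fun a ha => (hS a ha).2.1)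
  simp at this
  exact (ZMod.natCast_eq_zero_iff_even).1 this

theorem mat_ext {V : Type*} {G : SimpleGraph V} {S : Finset V} {f : V → V}
    (hS : Mat G S f) (n : ℕ) (hn : 2 * n ≤ S.card) :
    ∀ (k : ℕ) (T : Finset V), T ⊆ S → Mat G T f → T.card + k = 2 * n →
    ∃ T', T ⊆ T' ∧ T' ⊆ S ∧ Mat G T' f ∧ T'.card = 2 * n := by
  classical
  intro k
  induction k using Nat.strong_induction_on with
  | _ k ih =>
  intro T hT hm hk
  rcases Nat.eq_zero_or_pos k with rfl | hpos
  · exact ⟨T, subset_rfl, hT, hm, by omega⟩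
  have ev := mat_even hm
  obtain ⟨x, hxS, hxT⟩ : ∃ x ∈ S, x ∉ T := by
    by_contra! hh
    have := Finset.card_le_card (s := S) (t := T) hh
    omega
  have hx := hS x hxS
  have hfx : f x ∉ T := fun h => hxT (by have := (hm _ h).1; rwa [hx.2.1] at this)
  have hne : x ≠ f x := hx.2.2.ne
  have hcard : (insert x (insert (f x) T)).card = T.card + 2 := by
    rw [Finset.card_insert_of_notMem (by simp [hne, hxT]), Finset.card_insert_of_notMem hfx]
  obtain ⟨a, ha⟩ := ev
  obtain ⟨T', h1, h2, h3, h4⟩ := ih (k - 2) (by omega) (insert x (insert (f x) T))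
    (by intro y hy; simp at hy; rcases hy with rfl | rfl | hy
        · exact hxS
        · exact hx.1
        · exact hT hy)
    (by intro y hy; simp at hy; rcases hy with rfl | rfl | hy
        · exact ⟨by simp, hx.2⟩
        · exact ⟨by simp [hx.2.1], (hS _ hx.1).2⟩
        · exact ⟨by simp [(hm y hy).1], (hm y hy).2⟩)
    (by omega)
  exact ⟨T', fun y hy => h1 (by simp [hy]), h2, h3, h4⟩

theorem lem1 {V : Type*} [Fintype V] {G : SimpleGraph V} {n : ℕ} (h : G.IsNExtendable n)
    (S : Finset V) (f : V → V) (hS : Mat G S f) (hc : S.card ≤ 2 * n) :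
    ∃ g, Mat G Finset.univ g ∧ ∀ v ∈ S, g v = f v := by
  classical
  have key : ∀ k : ℕ, ∀ g, Mat G Finset.univ g →
      (S.filter (fun v => g v ≠ f v)).card = k →
      ∃ g, Mat G Finset.univ g ∧ ∀ v ∈ S, g v = f v := by
    intro k
    induction k using Nat.strong_induction_on with
    | _ k ih =>
    intro g hg hk
    by_cases hall : ∀ v ∈ S, g v = f v
    · exact ⟨g, hg, hall⟩
    push Not at hall
    obtain ⟨x, hxS, hx⟩ := hall
    have hg1 : ∀ u, g (g u) = u := fun u => (hg u (Finset.mem_univ _)).2.1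
    have hg2 : ∀ u, G.Adj u (g u) := fun u => (hg u (Finset.mem_univ _)).2.2
    have hg3 : ∀ u, g u ≠ u := fun u => (hg2 u).ne'
    obtain ⟨hyS, hyx, hxy⟩ := hS x hxS
    have hne := hxy.ne
    obtain ⟨y, hy⟩ : ∃ y, y = f x := ⟨_, rfl⟩
    rw [← hy] at hyS hyx hxy hne hx
    let S1 : Finset V := Finset.univ \ {g x, g y}
    let f1 : V → V := fun u => if u = x then y else if u = y then x else g u
    have hxx : g x ≠ g y := fun e => hne (by rw [← hg1 x, e, hg1])
    have hgyx : g y ≠ x := fun e => hx (by rw [← e, hg1])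
    have hm1 : Mat G S1 f1 := by
      intro u hu
      simp only [S1, Finset.mem_sdiff, Finset.mem_univ, Finset.mem_insert, Finset.mem_singleton,
        true_and, not_or] at hu ⊢
      simp only [f1]
      by_cases hux : u = x
      · subst hux
        have := hg3 y
        simp [Ne.symm hx, Ne.symm this, Ne.symm hne, hxy]
      by_cases huy : u = y
      · subst huy
        have := hg3 x
        simp [Ne.symm hgyx, Ne.symm this, hux, hxy.symm]
      have e1 : g u ≠ x := fun e => hu.1 (by rw [← e, hg1])
      have e2 : g u ≠ y := fun e => hu.2 (by rw [← e, hg1])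
      have e3 : g u ≠ g x := fun e => hux (by rw [← hg1 u, e, hg1])
      have e4 : g u ≠ g y := fun e => huy (by rw [← hg1 u, e, hg1])
      simp [hux, huy, e1, e2, e3, e4, hg1, hg2]
    let T := S1.filter (fun v => v ∈ S ∧ f1 v = f v)
    have hT : Mat G T f1 := by
      intro u hu
      simp only [T, Finset.mem_filter] at hu ⊢
      obtain ⟨h1, h2, h3⟩ := hu
      have a := hm1 u h1
      have b := hS u h2
      refine ⟨⟨a.1, h3 ▸ b.1, ?_⟩, a.2⟩
      rw [a.2.1, h3, b.2.1]
    have hTc : T.card ≤ S.card := Finset.card_le_card (fun u hu => (Finset.mem_filter.1 hu).2.1)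
    have hV := h.2.1
    have hS1c : 2 * n ≤ S1.card := by
      have := Finset.le_card_sdiff ({g x, g y} : Finset V) Finset.univ
      rw [Finset.card_univ, Finset.card_pair hxx] at this
      simp only [S1]; omega
    obtain ⟨T', t1, t2, t3, t4⟩ := mat_ext hm1 n hS1c (2 * n - T.card) T (Finset.filter_subset _ _)
      hT (by omega)
    obtain ⟨g', hg', hgg⟩ := hypX h T' f1 t3 t4
    refine ih _ ?_ g' hg' rfl
    rw [← hk]
    have hxT : x ∈ T := by
      simp only [T, S1, f1, Finset.mem_filter, Finset.mem_sdiff, Finset.mem_univ, Finset.mem_insert,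
        Finset.mem_singleton, true_and, not_or]
      exact ⟨⟨(hg3 x).symm, hgyx.symm⟩, hxS, by simp [hy]⟩
    apply Finset.card_lt_card
    rw [Finset.ssubset_iff_of_subset]
    · refine ⟨x, by simp [hxS, ← hy, hx], ?_⟩
      simp [hgg x (t1 hxT), hy, f1]
    · intro u hu
      simp only [Finset.mem_filter] at hu ⊢
      refine ⟨hu.1, fun e => hu.2 ?_⟩
      have hux : u ≠ x := fun e' => hx (by rw [← e', e, hy, e'])
      have huy : u ≠ y := fun e' => hgyx (by rw [← e', e, e', hyx])
      have hT : u ∈ T := by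
        simp only [T, S1, f1, Finset.mem_filter, Finset.mem_sdiff, Finset.mem_univ,
          Finset.mem_insert, Finset.mem_singleton, true_and, not_or]
        refine ⟨⟨fun e' => ?_, fun e' => ?_⟩, hu.1, by simp [hux, huy, e]⟩
        · apply hx
          have : f u = x := by rw [← e, e', hg1]
          rw [← e', hy, ← this, (hS u hu.1).2.1]
        · apply hgyx
          have : f u = y := by rw [← e, e', hg1]
          rw [← e', ← (hS u hu.1).2.1, this, hyx]
      rw [hgg u (t1 hT)]
      simp [f1, hux, huy, e]
  obtain ⟨M, hM, hMc⟩ := h.2.2.1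
  obtain ⟨f0, hf0, _⟩ := ofSub M hM
  obtain ⟨g, hg, _⟩ := hypX h _ f0 hf0 (by convert sum_edges M hM using 2; exact hMc.symm)
  exact key _ g hg rfl

theorem lem2 {V : Type*} [Fintype V] {G : SimpleGraph V} {n : ℕ} (h : G.IsNExtendable n)
    (Q : Finset V) (f : V → V) (hQ : Mat G Q f) (hc : Q.card = 2 * n) :
    ∀ v ∈ Q, ∃ o, o ∉ Q ∧ G.Adj v o := by
  classical
  -- swapping lemma
  have swap : ∀ a ∈ Q, ∀ o, o ∉ Q → ∀ f1, Mat G (insert o (Q.erase a)) f1 →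
      ∃ o, o ∉ Q ∧ G.Adj a o := by
    intro a ha o ho f1 hf1
    have hao : a ≠ o := fun e => ho (e ▸ ha)
    have hcard : (insert o (Q.erase a)).card = 2 * n := by
      rw [Finset.card_insert_of_notMem (by simp [ho]), Finset.card_erase_of_mem ha]
      have := Finset.card_pos.2 ⟨a, ha⟩
      omega
    obtain ⟨g, hg, hgg⟩ := hypX h _ f1 hf1 hcard
    have hga := hg a (Finset.mem_univ _)
    refine ⟨g a, fun hq => ?_, hga.2.2⟩
    have h1 : g a ∈ insert o (Q.erase a) := by simp [hq, hga.2.2.ne']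
    have h2 := (hf1 _ h1).1
    rw [← hgg _ h1, hga.2.1] at h2
    simp [hao] at h2
  have c1 : ∀ s ∈ Q, (∃ o, o ∉ Q ∧ G.Adj s o) → ∃ o, o ∉ Q ∧ G.Adj (f s) o := by
    rintro s hs ⟨o, ho, hso⟩
    have hs' := hQ s hs
    refine swap (f s) hs'.1 o ho (fun u => if u = s then o else if u = o then s else f u) ?_
    intro u hu
    simp only [Finset.mem_insert, Finset.mem_erase] at hu ⊢
    have hne := hso.ne
    by_cases hus : u = s
    · subst hus; simp [hne.symm, hso]
    by_cases huo : u = o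
    · subst huo; simp [hus, hs, hso.symm, hs'.2.2.ne]
    have hu := hu.resolve_left huo
    have hu' := hQ u hu.2
    have e1 : f u ≠ s := fun e => hu.1 (by rw [← e, hu'.2.1])
    have e2 : f u ≠ o := fun e => ho (e ▸ hu'.1)
    have e3 : f u ≠ f s := fun e => hus (by rw [← hu'.2.1, e, hs'.2.1])
    simp [hus, huo, e1, e2, e3, hu']
  have c2 : ∀ s ∈ Q, (∃ o, o ∉ Q ∧ G.Adj s o) → ∀ i ∈ Q, G.Adj s i → ∃ o, o ∉ Q ∧ G.Adj i o := by
    intro s hs hB i hi hsi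
    have hs' := hQ s hs
    have hi' := hQ i hi
    by_cases his : i = f s
    · rw [his]; exact c1 s hs hB
    obtain ⟨o, ho, hso⟩ := c1 s hs hB
    rw [← hi'.2.1]
    refine c1 (f i) hi'.1 ?_
    have n1 := hsi.ne
    have n2 : f s ≠ f i := fun e => n1 (by rw [← hs'.2.1, e, hi'.2.1])
    have n3 : s ≠ f i := fun e => his (by rw [e, hi'.2.1])
    have n4 := hs'.2.2.ne
    have n5 := hi'.2.2.ne
    have n6 : s ≠ o := fun e => ho (e ▸ hs)
    have n7 : i ≠ o := fun e => ho (e ▸ hi)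
    have n8 := hso.ne
    refine swap (f i) hi'.1 o ho (fun u => if u = s then i else if u = i then s else
      if u = f s then o else if u = o then f s else f u) ?_
    intro u hu
    simp only [Finset.mem_insert, Finset.mem_erase] at hu ⊢
    by_cases u1 : u = s
    · subst u1; simp [n1.symm, hsi, n5, hi]
    by_cases u2 : u = i
    · subst u2; simp [n1.symm, hsi.symm, n3, hs]
    by_cases u3 : u = f s
    · subst u3; simp [n4.symm, Ne.symm his, n6.symm, n7.symm, n8.symm, hso]
    by_cases u4 : u = o
    · subst u4; simp [n4.symm, Ne.symm his, n6.symm, n7.symm, n8.symm, n2, hs'.1, hso.symm]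
    have hu := hu.resolve_left u4
    have hu' := hQ u hu.2
    have e1 : f u ≠ s := fun e => u3 (by rw [← e, hu'.2.1])
    have e2 : f u ≠ o := fun e => ho (e ▸ hu'.1)
    have e3 : f u ≠ f s := fun e => u1 (by rw [← hu'.2.1, e, hs'.2.1])
    have e4 : f u ≠ i := fun e => hu.1 (by rw [← e, hu'.2.1])
    have e5 : f u ≠ f i := fun e => u2 (by rw [← hu'.2.1, e, hi'.2.1])
    simp [u1, u2, u3, u4, e1, e2, e3, e4, e5, hu']
  intro v hv
  by_contra hcon
  have hall : ∀ w, G.Reachable v w → w ∈ Q ∧ ¬ ∃ o, o ∉ Q ∧ G.Adj w o := by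
    rintro w ⟨p⟩
    induction p with
    | nil => exact ⟨hv, hcon⟩
    | @cons a b c hab p ih =>
      have hbQ : b ∈ Q := by
        by_contra hb; exact hcon ⟨b, hb, hab⟩
      exact ih hbQ (fun hB => hcon (c2 b hbQ hB a hv hab.symm))
  have hQu : Finset.univ ⊆ Q := fun w _ => (hall w (h.1.preconnected v w)).1
  have := Finset.card_le_card hQu
  rw [Finset.card_univ] at this
  have := h.2.1
  omega

/-- Dean's lemma: if `v` has degree `n + t` in an `n`-extendable graph `G`, then the
subgraph of `G` induced by the neighborhood of `v` has no matching of size `t`. -/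
theorem no_matching_in_neighborhood {V : Type*} [Fintype V] (G : SimpleGraph V)
    [DecidableRel G.Adj] (n t : ℕ) (h : G.IsNExtendable n) (v : V)
    (hv : G.degree v = n + t) :
    ¬ ∃ M : (G.induce (G.neighborSet v)).Subgraph, M.IsMatching ∧ M.edgeSet.ncard = t := by
  classical
  rintro ⟨M, hM, hMc⟩
  obtain ⟨f, hf, -⟩ := ofSub M hM
  have hc := sum_edges M hM
  rw [hMc] at hc
  let S : Finset V := M.verts.toFinset.map (Function.Embedding.subtype _)
  let f' : V → V := fun u => if hu : u ∈ G.neighborSet v then (f ⟨u, hu⟩ : V) else u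
  have hSN : S ⊆ G.neighborFinset v := by
    intro u hu
    obtain ⟨⟨w, hw⟩, _, rfl⟩ := Finset.mem_map.1 hu
    simpa using hw
  have hS : Mat G S f' := by
    intro u hu
    obtain ⟨⟨w, hw⟩, hw1, rfl⟩ := Finset.mem_map.1 hu
    obtain ⟨h1, h2, h3⟩ := hf _ hw1
    have e1 : f' w = (f ⟨w, hw⟩ : V) := by simp only [f']; rw [dif_pos hw]
    have e2 : f' (f ⟨w, hw⟩ : V) = w := by
      simp only [f']; rw [dif_pos (f ⟨w, hw⟩).2]
      exact congrArg Subtype.val h2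
    simp only [Function.Embedding.subtype_apply]
    rw [e1, e2]
    exact ⟨Finset.mem_map.2 ⟨_, h1, rfl⟩, rfl, h3⟩
  have hScard : S.card = 2 * t := by
    simp only [S, Finset.card_map]; exact hc
  have hle := Finset.card_le_card hSN
  rw [SimpleGraph.card_neighborFinset_eq_degree, hv, hScard] at hle
  obtain ⟨g, hg, hgS⟩ := lem1 h S f' hS (by omega)
  have hg1 : ∀ u, g (g u) = u := fun u => (hg u (Finset.mem_univ _)).2.1
  let W := G.neighborFinset v \ S
  have hW : W.card = n + t - 2 * t := by
    simp only [W]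
    rw [Finset.card_sdiff_of_subset hSN, SimpleGraph.card_neighborFinset_eq_degree, hv, hScard]
  let T := S ∪ (W ∪ W.image g)
  have hTc : T.card ≤ 2 * n := by
    have a1 := Finset.card_union_le S (W ∪ W.image g)
    have a2 := Finset.card_union_le W (W.image g)
    have a3 := Finset.card_image_le (s := W) (f := g)
    simp only [T]; omega
  have hT : Mat G T g := by
    intro u hu
    refine ⟨?_, (hg u (Finset.mem_univ _)).2⟩
    simp only [T, Finset.mem_union, Finset.mem_image] at hu ⊢
    rcases hu with hu | hu | ⟨w, hw, rfl⟩
    · left; rw [hgS u hu]; exact (hS u hu).1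
    · right; right; exact ⟨u, hu, rfl⟩
    · right; left; rwa [hg1]
  have hV := h.2.1
  obtain ⟨T', t1, -, t3, t4⟩ := mat_ext hg n (by rw [Finset.card_univ]; omega) (2 * n - T.card) T
    (Finset.subset_univ _) hT (by omega)
  have hN : ∀ u, G.Adj v u → u ∈ T' := by
    intro u hu
    apply t1
    simp only [T, W, Finset.mem_union, Finset.mem_sdiff, SimpleGraph.mem_neighborFinset]
    tauto
  have hvT : v ∈ T' := by
    have := (t3 _ (hN _ (hg v (Finset.mem_univ _)).2.2)).1
    rwa [hg1] at this
  obtain ⟨o, ho, hvo⟩ := lem2 h T' g t3 t4 v hvT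
  exact ho (hN o hvo)
end

section
/- For every integer k ≥ 2, every k-factor-critical graph of order n > k is (k−2)-factor-critical. -/
/-- A graph `G` of order `n` on a finite vertex type is `k`-factor-critical
(`0 ≤ k < n`, `n + k` even) if deleting any set of `k` vertices leaves a graph
with a perfect matching. -/
def SimpleGraph.IsFactorCritical {V : Type*} [Fintype V] (G : SimpleGraph V) (k : ℕ) : Prop :=
  k < Fintype.card V ∧ Even (Fintype.card V + k) ∧
    ∀ S : Finset V, S.card = k →
      ∃ M : (G.induce ((↑S : Set V)ᶜ)).Subgraph, M.IsPerfectMatching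

/-- For `k ≥ 2`, every `k`-factor-critical graph is `(k-2)`-factor-critical. -/
theorem factorCritical_sub_two {V : Type*} [Fintype V] (G : SimpleGraph V) (k : ℕ)
    (hk : 2 ≤ k) (h : G.IsFactorCritical k) : G.IsFactorCritical (k - 2) := by
  classical
  obtain ⟨hlt, hev, hM⟩ := h
  refine ⟨by omega, ?_, ?_⟩
  · rw [Nat.even_iff] at hev ⊢
    omega
  intro S hS
  obtain ⟨T, hST, hT⟩ := Finset.exists_superset_card_eq (s := S) (n := k) (by omega) hlt.le
  obtain ⟨M, hMT⟩ := hM T hT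
  obtain ⟨w, hw⟩ : ∃ w, w ∉ T := by
    by_contra! hc
    have := Finset.card_le_card (show Finset.univ ⊆ T from fun x _ => hc x)
    rw [Finset.card_univ] at this
    omega
  rw [SimpleGraph.Subgraph.isPerfectMatching_iff] at hMT
  obtain ⟨⟨w', hw'⟩, hadj, -⟩ := hMT ⟨w, by simpa using hw⟩
  have hG : G.Adj w w' := hadj.adj_sub
  have hw' : w' ∉ T := by simpa using hw'
  have hne : w ≠ w' := hG.ne
  have hwS : w ∉ S := fun h => hw (hST h)
  have hwS' : w' ∉ S := fun h => hw' (hST h)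
  obtain ⟨R, memR, N, hN⟩ : ∃ R : Set V, (∀ x, x ∈ R ↔ x ≠ w ∧ x ≠ w' ∧ x ∉ S) ∧
      ∃ N : (G.induce R).Subgraph, N.IsPerfectMatching := by
    refine ⟨_, fun x => ?_, hM (insert w (insert w' S)) ?_⟩
    · simp
    rw [Finset.card_insert_of_notMem (by simp [hne, hwS]), Finset.card_insert_of_notMem hwS']
    omega
  rw [SimpleGraph.Subgraph.isPerfectMatching_iff] at hN
  refine ⟨{ verts := Set.univ
            Adj := fun a b => (∃ ha : a.1 ∈ R, ∃ hb : b.1 ∈ R, N.Adj ⟨a.1, ha⟩ ⟨b.1, hb⟩) ∨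
              (a.1 = w ∧ b.1 = w') ∨ (a.1 = w' ∧ b.1 = w)
            adj_sub := ?_
            edge_vert := fun _ => Set.mem_univ _
            symm := ?_ }, ?_⟩
  · rintro ⟨a, ha⟩ ⟨b, hb⟩ (⟨h1, h2, h3⟩ | ⟨h1, h2⟩ | ⟨h1, h2⟩)
    · exact h3.adj_sub
    · subst h1 h2
      exact hG
    · subst h1 h2
      exact hG.symm
  · refine ⟨?_⟩
    rintro ⟨a, ha⟩ ⟨b, hb⟩ (⟨h1, h2, h3⟩ | ⟨h1, h2⟩ | ⟨h1, h2⟩)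
    · exact Or.inl ⟨h2, h1, h3.symm⟩
    · exact Or.inr (Or.inr ⟨h2, h1⟩)
    · exact Or.inr (Or.inl ⟨h2, h1⟩)
  · rw [SimpleGraph.Subgraph.isPerfectMatching_iff]
    rintro ⟨a, ha⟩
    by_cases h1 : a = w
    · refine ⟨⟨w', by simpa using hwS'⟩, Or.inr (Or.inl ⟨h1, rfl⟩), ?_⟩
      rintro ⟨b, hb⟩ (⟨h3, -, -⟩ | ⟨-, h3⟩ | ⟨h3, -⟩)
      · exact absurd h1 ((memR _).1 h3).1
      · exact Subtype.ext h3
      · exact absurd (h1.symm.trans h3) hne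
    by_cases h2 : a = w'
    · refine ⟨⟨w, by simpa using hwS⟩, Or.inr (Or.inr ⟨h2, rfl⟩), ?_⟩
      rintro ⟨b, hb⟩ (⟨h3, -, -⟩ | ⟨h3, -⟩ | ⟨-, h3⟩)
      · exact absurd h2 ((memR _).1 h3).2.1
      · exact absurd h3 h1
      · exact Subtype.ext h3
    have haR : a ∈ R := (memR a).2 ⟨h1, h2, by simpa using ha⟩
    obtain ⟨⟨b, hb⟩, hab, huniq⟩ := hN ⟨a, haR⟩
    refine ⟨⟨b, by simpa using ((memR b).1 hb).2.2⟩, Or.inl ⟨haR, hb, hab⟩, ?_⟩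
    rintro ⟨c, hc⟩ (⟨_, h4, h5⟩ | ⟨h3, -⟩ | ⟨h3, -⟩)
    · have h6 := huniq ⟨c, h4⟩ h5
      rw [Subtype.mk.injEq] at h6
      exact Subtype.ext h6
    · exact absurd h3 h1
    · exact absurd h3 h2
end

section
/- For every integer k ≥ 1, every k-factor-critical graph of order n > k is k-connected, i.e., G has more than k vertices and the deletion of any set of fewer than k vertices from G leaves a connected graph. -/
open Classical in
lemma fc_even_aux {V : Type*} [Fintype V] (G : SimpleGraph V) (A R : Finset V)
    (hA : ∀ v ∈ A, ∀ w, w ∉ R → G.Adj v w → w ∈ A)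
    (M : (G.induce ((↑R : Set V)ᶜ)).Subgraph) (hM : M.IsPerfectMatching) :
    Even (A \ R).card := by
  set u : Set ((↑R : Set V)ᶜ : Set V) := {v | (v : V) ∈ A} with hu
  have hm : (M.induce u).IsMatching := by
    intro v hv
    have hv' : (v : V) ∈ A := hv
    obtain ⟨w, hw, huniq⟩ := hM.1 (hM.2 v)
    refine ⟨w, ?_, ?_⟩
    · refine ⟨hv, ?_, hw⟩
      have hadj : G.Adj (v : V) (w : V) := M.adj_sub hw
      exact hA v hv' w (fun hh => w.2 (Finset.mem_coe.2 hh)) hadj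
    · intro y hy
      exact huniq y hy.2.2
  have he := hm.even_card
  have hc : (M.induce u).verts.toFinset.card = (A \ R).card := by
    refine Finset.card_bij (fun x _ => (x : V)) ?_ ?_ ?_
    · intro x hx
      have h1 : (x : V) ∈ A := by simpa [hu] using hx
      have h2 : (x : V) ∉ R := fun hh => x.2 (Finset.mem_coe.2 hh)
      simp [h1, h2]
    · intro x _ y _ hxy
      exact Subtype.ext hxy
    · intro b hb
      rw [Finset.mem_sdiff] at hb
      exact ⟨⟨b, by simpa using hb.2⟩, by simpa [hu] using hb.1, rfl⟩
  rwa [hc] at he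

open Classical in
lemma fc_pre_aux {V : Type*} [Fintype V] (G : SimpleGraph V) (k : ℕ)
    (h : G.IsFactorCritical k) (S : Finset V) (hS : S.card < k) :
    (G.induce ((↑S : Set V)ᶜ)).Preconnected := by
  obtain ⟨hn, -, hf⟩ := h
  intro a b
  by_contra hab
  have hne : (a : V) ≠ b := by
    intro e
    apply hab
    rw [Subtype.ext e]
  have haS : (a : V) ∉ S := fun hh => a.2 (Finset.mem_coe.2 hh)
  have hbS : (b : V) ∉ S := fun hh => b.2 (Finset.mem_coe.2 hh)
  let A : Finset V := Finset.univ.filter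
    (fun v => ∃ hv : v ∈ ((↑S : Set V)ᶜ), (G.induce ((↑S : Set V)ᶜ)).Reachable a ⟨v, hv⟩)
  have haA : (a : V) ∈ A := by
    simp only [A, Finset.mem_filter, Finset.mem_univ, true_and]
    exact ⟨a.2, SimpleGraph.Reachable.refl _⟩
  have hbA : (b : V) ∉ A := by
    simp only [A, Finset.mem_filter, Finset.mem_univ, true_and]
    rintro ⟨_, hb⟩
    exact hab hb
  have hA : ∀ v ∈ A, ∀ w, w ∉ S → G.Adj v w → w ∈ A := by
    intro v hv w hw hvw
    simp only [A, Finset.mem_filter, Finset.mem_univ, true_and] at hv ⊢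
    obtain ⟨hvS, hr⟩ := hv
    have hw' : w ∈ ((↑S : Set V)ᶜ) := by simpa using hw
    refine ⟨hw', hr.trans (SimpleGraph.Adj.reachable ?_)⟩
    simpa using hvw
  obtain ⟨R, h1, h2, h3⟩ : ∃ R, insert (a : V) S ⊆ R ∧ R ⊆ Finset.univ.erase (b : V) ∧
      R.card = k := by
    apply Finset.exists_subsuperset_card_eq
    · intro x hx
      simp only [Finset.mem_insert] at hx
      simp only [Finset.mem_erase, Finset.mem_univ, and_true]
      rintro rfl
      rcases hx with hx | hx
      · exact hne hx.symm
      · exact hbS hx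
    · rw [Finset.card_insert_of_notMem haS]; omega
    · rw [Finset.card_erase_of_mem (Finset.mem_univ _), Finset.card_univ]; omega
  have haR : (a : V) ∈ R := h1 (Finset.mem_insert_self _ _)
  have hSR : S ⊆ R := (Finset.subset_insert _ _).trans h1
  have hbR : (b : V) ∉ R := fun hb => by simpa using h2 hb
  have hbR' : (b : V) ∉ R.erase a := fun hb => hbR (Finset.mem_of_mem_erase hb)
  set Q : Finset V := insert (b : V) (R.erase a) with hQ
  have hQc : Q.card = k := by
    rw [hQ, Finset.card_insert_of_notMem hbR', Finset.card_erase_of_mem haR]; omega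
  have hSQ : S ⊆ Q := by
    intro x hx
    refine Finset.mem_insert_of_mem (Finset.mem_erase.2 ⟨?_, hSR hx⟩)
    rintro rfl
    exact haS hx
  obtain ⟨M, hM⟩ := hf R h3
  obtain ⟨N, hN⟩ := hf Q hQc
  have e1 := fc_even_aux G A R (fun v hv w hw => hA v hv w (fun h => hw (hSR h))) M hM
  have e2 := fc_even_aux G A Q (fun v hv w hw => hA v hv w (fun h => hw (hSQ h))) N hN
  have hins : A \ Q = insert (a : V) (A \ R) := by
    ext x
    simp only [hQ, Finset.mem_sdiff, Finset.mem_insert, Finset.mem_erase]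
    by_cases hxa : x = a
    · subst hxa; simp [haA, hne]
    · by_cases hxb : x = b
      · subst hxb; simp [hbA, hxa]
      · simp [hxa, hxb]
  rw [hins, Finset.card_insert_of_notMem (by simp [haR])] at e2
  exact (Nat.even_add_one.1 e2) e1

/-- For `k ≥ 1`, every `k`-factor-critical graph is `k`-connected: it has more than
`k` vertices, and deleting any set of fewer than `k` vertices leaves a connected graph. -/
theorem factorCritical_connectivity {V : Type*} [Fintype V] (G : SimpleGraph V) (k : ℕ)
    (hk : 1 ≤ k) (h : G.IsFactorCritical k) :
    k < Fintype.card V ∧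
      ∀ S : Finset V, S.card < k → (G.induce ((↑S : Set V)ᶜ)).Connected := by
  refine ⟨h.1, fun S hS => ?_⟩
  have hn := h.1
  obtain ⟨x, hx⟩ : ∃ x, x ∉ S := by
    by_contra hc
    push Not at hc
    have : S = Finset.univ := Finset.eq_univ_iff_forall.2 hc
    rw [this, Finset.card_univ] at hS
    omega
  haveI : Nonempty ((↑S : Set V)ᶜ : Set V) := ⟨⟨x, by simpa using hx⟩⟩
  exact SimpleGraph.Connected.mk (fc_pre_aux G k h S hS)
end

section
/- For every integer k ≥ 1, every k-factor-critical graph of order n > k is (k+1)-edge-connected, i.e., the deletion of any set of at most k edges from G leaves a connected graph. -/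
open Classical in
theorem fc_odd_closed {V : Type*} [Fintype V] (G : SimpleGraph V) (k : ℕ)
    (h : G.IsFactorCritical k) (S C : Finset V) (hS : S.card = k) (hd : ∀ v ∈ C, v ∉ S)
    (hC : Odd C.card) (hcl : ∀ v ∈ C, ∀ w, G.Adj v w → w ∈ C ∨ w ∈ S) : False := by
  obtain ⟨M, hM⟩ := h.2.2 S hS
  have hM' := SimpleGraph.Subgraph.isPerfectMatching_iff.1 hM
  have hm : (M.induce {x | (x : V) ∈ C}).IsMatching := by
    intro v hv
    have hvC : (v : V) ∈ C := hv
    obtain ⟨w, hw, hu⟩ := hM' v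
    have hwC : (w : V) ∈ C := by
      rcases hcl v hvC w (M.adj_sub hw) with h1 | h1
      · exact h1
      · exact absurd h1 w.2
    refine ⟨w, ⟨hvC, hwC, hw⟩, ?_⟩
    rintro y ⟨_, _, hy⟩
    exact hu y hy
  have he := hm.even_card
  have hc : (M.induce {x | (x : V) ∈ C}).verts.toFinset.card = C.card := by
    apply Finset.card_bij (fun (x : ((↑S : Set V)ᶜ : Set V)) _ => (x : V))
    · intro a ha
      simpa using ha
    · intro a _ b _ hab
      exact Subtype.ext hab
    · intro b hb
      exact ⟨⟨b, fun hb' => hd b hb hb'⟩, by simpa using hb, rfl⟩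
  rw [hc] at he
  exact (Nat.not_even_iff_odd.2 hC) he

open Classical in
theorem fc_degree {V : Type*} [Fintype V] (G : SimpleGraph V) (k : ℕ)
    (h : G.IsFactorCritical k) (v : V) : k + 1 ≤ (Finset.univ.filter (fun w => G.Adj v w)).card := by
  by_contra hlt
  have hsub : Finset.univ.filter (fun w => G.Adj v w) ⊆ Finset.univ.erase v := by
    intro w hw
    simp only [Finset.mem_filter, Finset.mem_univ, true_and] at hw
    simp [hw.ne']
  have h1 := h.1
  obtain ⟨S, hS1, hS2, hS3⟩ := Finset.exists_subsuperset_card_eq (n := k) hsub (by omega)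
    (by rw [Finset.card_erase_of_mem (Finset.mem_univ v), Finset.card_univ]; omega)
  refine fc_odd_closed G k h S {v} hS3 ?_ (by simp) ?_
  · intro x hx hxS
    have := hS2 hxS
    simp_all
  · intro x hx w hw
    right
    apply hS1
    simp_all

open Classical in
theorem fc_cross {V : Type*} [Fintype V] (G : SimpleGraph V) (k : ℕ)
    (A : Finset V) (E : Finset (Sym2 V)) (hE : E.card ≤ k)
    (hcr : ∀ u ∈ A, ∀ w, w ∉ A → G.Adj u w → s(u, w) ∈ E) :
    ((A ×ˢ Aᶜ).filter (fun p => G.Adj p.1 p.2)).card ≤ k := by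
  refine le_trans ?_ hE
  apply Finset.card_le_card_of_injOn (fun p => s(p.1, p.2))
  · rintro ⟨a, b⟩ hp
    simp only [Finset.coe_filter, Finset.mem_product, Finset.mem_compl, Set.mem_ofPred_eq] at hp
    exact hcr a hp.1.1 b hp.1.2 hp.2
  · rintro ⟨a, b⟩ hp ⟨c, d⟩ hq hpq
    simp only [Finset.coe_filter, Finset.mem_product, Finset.mem_compl, Set.mem_ofPred_eq] at hp hq
    simp only [Sym2.eq_iff] at hpq
    rcases hpq with ⟨rfl, rfl⟩ | ⟨rfl, rfl⟩
    · rfl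
    · exact absurd hp.1.1 hq.1.2

open Classical in
theorem fc_size {V : Type*} [Fintype V] (G : SimpleGraph V) (k : ℕ)
    (h : G.IsFactorCritical k) (A : Finset V) (hA : A.Nonempty)
    (hP : ((A ×ˢ Aᶜ).filter (fun p => G.Adj p.1 p.2)).card ≤ k) : k + 2 ≤ A.card := by
  have hsum : ((A ×ˢ Aᶜ).filter (fun p => G.Adj p.1 p.2)).card
      = ∑ v ∈ A, (Aᶜ.filter (fun w => G.Adj v w)).card := by
    rw [Finset.card_filter, Finset.sum_product]
    simp only [Finset.card_filter]
  have hv : ∀ v ∈ A, k + 1 ≤ (A.card - 1) + (Aᶜ.filter (fun w => G.Adj v w)).card := by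
    intro v hv
    refine le_trans (fc_degree G k h v) ?_
    rw [← Finset.card_erase_of_mem hv]
    refine le_trans (Finset.card_le_card ?_) (Finset.card_union_le _ _)
    intro w hw
    simp only [Finset.mem_filter, Finset.mem_univ, true_and] at hw
    by_cases hwA : w ∈ A
    · simp [hwA, hw.ne']
    · simp [hwA, hw]
  have h2 := Finset.sum_le_sum hv
  rw [Finset.sum_const, Finset.sum_add_distrib, ← hsum, Finset.sum_const] at h2
  simp only [smul_eq_mul] at h2
  have hpos := hA.card_pos
  by_contra hlt
  obtain ⟨a, ha⟩ : ∃ a, A.card = a + 1 := ⟨A.card - 1, by omega⟩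
  rw [ha] at h2 hlt
  obtain ⟨b, rfl⟩ : ∃ b, k = a + b := ⟨k - a, by omega⟩
  simp only [Nat.add_sub_cancel] at h2
  nlinarith [Nat.zero_le (a * b)]

open Classical in
theorem fc_main {V : Type*} [Fintype V] (G : SimpleGraph V) (k : ℕ) (hk : 1 ≤ k)
    (h : G.IsFactorCritical k) (A : Finset V) (hA : A.Nonempty) (hB : Aᶜ.Nonempty)
    (E : Finset (Sym2 V)) (hE : E.card ≤ k)
    (hcr : ∀ u ∈ A, ∀ w, w ∉ A → G.Adj u w → s(u, w) ∈ E) : False := by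
  have hP := fc_cross G k A E hE hcr
  have hBk : k + 2 ≤ Aᶜ.card := by
    apply fc_size G k h Aᶜ hB
    apply fc_cross G k Aᶜ E hE
    intro u hu w hw huw
    rw [Sym2.eq_swap]
    exact hcr w (by simpa using hw) u (by simpa using hu) huw.symm
  set P := (A ×ˢ Aᶜ).filter (fun p => G.Adj p.1 p.2) with hPdef
  have hmem : ∀ u w, (u, w) ∈ P ↔ (u ∈ A ∧ w ∉ A) ∧ G.Adj u w := by
    intro u w
    simp [hPdef]
  rcases Nat.even_or_odd A.card with he | ho
  · obtain ⟨v, hvA, hv⟩ : ∃ v ∈ A, (P.filter (fun p => p.1 ≠ v)).card ≤ k - 1 := by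
      rcases P.eq_empty_or_nonempty with h0 | ⟨⟨v, w⟩, hvw⟩
      · obtain ⟨v, hv⟩ := hA
        exact ⟨v, hv, by simp [h0]⟩
      · refine ⟨v, ((hmem v w).1 hvw).1.1, ?_⟩
        have : (P.filter (fun p => p.1 ≠ v)).card < P.card := by
          apply Finset.card_lt_card
          rw [Finset.filter_ssubset]
          exact ⟨(v, w), hvw, by simp⟩
        omega
    have hsub : (P.filter (fun p => p.1 ≠ v)).image Prod.snd ⊆ Aᶜ := by
      intro w hw
      obtain ⟨⟨a, b⟩, hp, rfl⟩ := Finset.mem_image.1 hw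
      have := (hmem a b).1 (Finset.mem_filter.1 hp).1
      simpa using this.1.2
    obtain ⟨S, hS1, hS2, hS3⟩ := Finset.exists_subsuperset_card_eq (n := k - 1) hsub
      (le_trans Finset.card_image_le hv) (by omega)
    have hvS : v ∉ S := fun hx => (Finset.mem_compl.1 (hS2 hx)) hvA
    refine fc_odd_closed G k h (insert v S) (A.erase v) ?_ ?_ ?_ ?_
    · rw [Finset.card_insert_of_notMem hvS]; omega
    · intro x hx hxS
      rw [Finset.mem_erase] at hx
      rcases Finset.mem_insert.1 hxS with h1 | h1
      · exact hx.1 h1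
      · exact (Finset.mem_compl.1 (hS2 h1)) hx.2
    · rw [Finset.card_erase_of_mem hvA]
      exact Nat.Even.sub_odd hA.card_pos he odd_one
    · intro x hx w hw
      rw [Finset.mem_erase] at hx
      by_cases hwv : w = v
      · right; simp [hwv]
      by_cases hwA : w ∈ A
      · left; simp [hwv, hwA]
      · right
        apply Finset.mem_insert_of_mem
        apply hS1
        exact Finset.mem_image.2 ⟨(x, w),
          Finset.mem_filter.2 ⟨(hmem x w).2 ⟨⟨hx.2, hwA⟩, hw⟩, hx.1⟩, rfl⟩
  · have hsub : P.image Prod.snd ⊆ Aᶜ := by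
      intro w hw
      obtain ⟨⟨a, b⟩, hp, rfl⟩ := Finset.mem_image.1 hw
      have := (hmem a b).1 hp
      simpa using this.1.2
    obtain ⟨S, hS1, hS2, hS3⟩ := Finset.exists_subsuperset_card_eq (n := k) hsub
      (le_trans Finset.card_image_le hP) (by omega)
    refine fc_odd_closed G k h S A hS3 ?_ ho ?_
    · intro x hx hxS
      exact (Finset.mem_compl.1 (hS2 hxS)) hx
    · intro x hx w hw
      by_cases hwA : w ∈ A
      · exact Or.inl hwA
      · right
        apply hS1
        exact Finset.mem_image.2 ⟨(x, w), (hmem x w).2 ⟨⟨hx, hwA⟩, hw⟩, rfl⟩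

/-- For `k ≥ 1`, every `k`-factor-critical graph is `(k+1)`-edge-connected: deleting
any set of at most `k` edges leaves a connected graph. -/
theorem factorCritical_edgeConnectivity {V : Type*} [Fintype V] (G : SimpleGraph V)
    (k : ℕ) (hk : 1 ≤ k) (h : G.IsFactorCritical k) :
    ∀ E : Finset (Sym2 V), ↑E ⊆ G.edgeSet → E.card ≤ k →
      (G.deleteEdges (↑E : Set (Sym2 V))).Connected := by
  classical
  intro E _ hE
  have hne : Nonempty V := Fintype.card_pos_iff.1 (lt_of_le_of_lt (Nat.zero_le k) h.1)
  refine SimpleGraph.connected_iff _ |>.2 ⟨?_, hne⟩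
  intro u v
  by_contra huv
  refine fc_main G k hk h
    (Finset.univ.filter (fun w => (G.deleteEdges (↑E : Set (Sym2 V))).Reachable u w))
    ⟨u, by simp⟩ ⟨v, by simpa using huv⟩ E hE ?_
  intro a ha b hb hab
  simp only [Finset.mem_filter, Finset.mem_univ, true_and] at ha hb
  by_contra hnE
  refine hb (ha.trans (SimpleGraph.Adj.reachable ?_))
  rw [SimpleGraph.deleteEdges_adj]
  exact ⟨hab, by simpa using hnE⟩
end
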